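/- Assume (F), (W) and (P2). Suppose ρ_R≤ρ_L≤ρ̄ and p(ρ_L+)<f(ρ_L)≤p(ρ_L−) (case (CN3)). Then there exist T>0 and two entropy weak solutions ρ¹, ρ² on [0,T) of the constrained Riemann problem with non-local constraint such that f(ρ¹(t,0−))=f(ρ¹(t,0+))=f(ρ_L) and f(ρ²(t,0−))=f(ρ²(t,0+))=p(ρ_L+) for a.e. t∈(0,T); in particular ρ¹ and ρ² do not coincide a.e. on (0,τ)×ℝ for any τ∈(0,T], so the problem admits more than one entropy weak solution. -/

import Mathlib

open MeasureTheory Set Filter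

namespace CRP

noncomputable section

/-- Smooth compactly supported test functions on `ℝ²`. -/
def TestFn (φ : ℝ × ℝ → ℝ) : Prop :=
  ContDiff ℝ (⊤ : ℕ∞) φ ∧ HasCompactSupport φ

/-- Partial derivative of a test function in the first (time) variable. -/
def pdT (φ : ℝ × ℝ → ℝ) (z : ℝ × ℝ) : ℝ := fderiv ℝ φ z (1, 0)

/-- Partial derivative of a test function in the second (space) variable. -/
def pdX (φ : ℝ × ℝ → ℝ) (z : ℝ × ℝ) : ℝ := fderiv ℝ φ z (0, 1)

/-- Assumption (F): `f : [0,R] → [0,∞)` is Lipschitz, `f 0 = 0 = f R`, and there is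
`ρb ∈ (0,R)` with `f' ρ * (ρb - ρ) > 0` for a.e. `ρ ∈ [0,R]`. -/
def AF (R ρb : ℝ) (f : ℝ → ℝ) : Prop :=
  0 < R ∧ (∃ L : NNReal, LipschitzOnWith L f (Icc 0 R)) ∧
    (∀ x ∈ Icc (0:ℝ) R, 0 ≤ f x) ∧ f 0 = 0 ∧ f R = 0 ∧ ρb ∈ Ioo 0 R ∧
    (∀ᵐ x ∂(volume.restrict (Icc (0:ℝ) R)), deriv f x * (ρb - x) > 0)

/-- Assumption (W): `w` is a nonnegative non-decreasing weight on `ℝ₋` with unit integral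
and support in `[-i_w, 0]`. -/
def AW (w : ℝ → ℝ) : Prop :=
  (∀ x ≤ (0:ℝ), 0 ≤ w x) ∧ MonotoneOn w (Iic 0) ∧
    (∫ x in Iic (0:ℝ), w x) = 1 ∧ ∃ iw : ℝ, 0 < iw ∧ ∀ x ≤ -iw, w x = 0

/-- Assumption (P2): `p : [0,R] → (0, fmax]` is non-increasing and piecewise constant
with finitely many jumps (equivalently, it has finitely many values). -/
def AP2 (R fmax : ℝ) (p : ℝ → ℝ) : Prop :=
  AntitoneOn p (Icc 0 R) ∧ (∀ ξ ∈ Icc (0:ℝ) R, p ξ ∈ Ioc 0 fmax) ∧ (p '' Icc 0 R).Finite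

/-- The left limit `p(ξ−)` of a non-increasing piecewise constant `p` on `[0,R]`,
with the convention `p(0−) = p 0`. -/
def pminus (p : ℝ → ℝ) (ξ : ℝ) : ℝ := if ξ ≤ 0 then p 0 else sInf (p '' Ico 0 ξ)

/-- The right limit `p(ξ+)` of a non-increasing piecewise constant `p` on `[0,R]`,
with the convention `p(R+) = p R`. -/
def pplus (R : ℝ) (p : ℝ → ℝ) (ξ : ℝ) : ℝ := if R ≤ ξ then p R else sSup (p '' Ioc ξ R)

/-- `γ` is the left measure-theoretic trace of `ρ` at `x = 0`. -/
def LeftTraceAt (ρ : ℝ → ℝ → ℝ) (γ : ℝ → ℝ) : Prop :=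
  ∀ φ : ℝ × ℝ → ℝ, TestFn φ →
    Tendsto (fun ε : ℝ => (1 / ε) * ∫ t in Ioi (0:ℝ), ∫ x in Ioo (-ε) (0:ℝ),
        |ρ t x - γ t| * φ (t, x)) (nhdsWithin 0 (Ioi 0)) (nhds 0)

/-- `γ` is the right measure-theoretic trace of `ρ` at `x = 0`. -/
def RightTraceAt (ρ : ℝ → ℝ → ℝ) (γ : ℝ → ℝ) : Prop :=
  ∀ φ : ℝ × ℝ → ℝ, TestFn φ →
    Tendsto (fun ε : ℝ => (1 / ε) * ∫ t in Ioi (0:ℝ), ∫ x in Ioo (0:ℝ) ε,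
        |ρ t x - γ t| * φ (t, x)) (nhdsWithin 0 (Ioi 0)) (nhds 0)

/-- The constrained entropy inequality (i), with constraint level `q`, initial datum `ρ0`,
tested on all nonnegative test functions. -/
def EntIneq (R fmax : ℝ) (f q ρ0 : ℝ → ℝ) (ρ : ℝ → ℝ → ℝ) : Prop :=
  ∀ φ : ℝ × ℝ → ℝ, TestFn φ → (∀ z, 0 ≤ φ z) → ∀ k ∈ Icc (0:ℝ) R,
    0 ≤ (∫ t in Ioi (0:ℝ), ∫ x : ℝ,
          (|ρ t x - k| * pdT φ (t, x) +
            Real.sign (ρ t x - k) * (f (ρ t x) - f k) * pdX φ (t, x))) +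
        2 * (∫ t in Ioi (0:ℝ), (1 - q t / fmax) * f k * φ (t, 0)) +
        ∫ x : ℝ, |ρ0 x - k| * φ (0, x)

/-- The constrained entropy inequality (i) on the time interval `[0,T)`: only test
functions supported in `(-∞,T) × ℝ` are used. -/
def EntIneqOn (R fmax T : ℝ) (f q ρ0 : ℝ → ℝ) (ρ : ℝ → ℝ → ℝ) : Prop :=
  ∀ φ : ℝ × ℝ → ℝ, TestFn φ → (∀ z, 0 ≤ φ z) →
    tsupport φ ⊆ Iio T ×ˢ (univ : Set ℝ) → ∀ k ∈ Icc (0:ℝ) R,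
    0 ≤ (∫ t in Ioi (0:ℝ), ∫ x : ℝ,
          (|ρ t x - k| * pdT φ (t, x) +
            Real.sign (ρ t x - k) * (f (ρ t x) - f k) * pdX φ (t, x))) +
        2 * (∫ t in Ioi (0:ℝ), (1 - q t / fmax) * f k * φ (t, 0)) +
        ∫ x : ℝ, |ρ0 x - k| * φ (0, x)

/-- Basic regularity required of solutions: measurability, values in `[0,R]`, and
continuity in time with values in `L¹loc` (on compact sets `[-r,r]`). -/
def RegSol (R : ℝ) (ρ : ℝ → ℝ → ℝ) : Prop :=
  Measurable (Function.uncurry ρ) ∧ (∀ t x, ρ t x ∈ Icc (0:ℝ) R) ∧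
    ∀ r : ℝ, 0 < r → ∀ s : ℝ, 0 ≤ s →
      Tendsto (fun t => ∫ x in Icc (-r) r, |ρ t x - ρ s x|) (nhdsWithin s (Ici 0)) (nhds 0)

/-- `ρ`, with traces `γm`, `γp` at `x = 0`, satisfies the constrained entropy
inequalities with constraint level `q : (0,∞) → [0,fmax]` and initial datum `ρ0`. -/
def CEI (R fmax : ℝ) (f q ρ0 : ℝ → ℝ) (ρ : ℝ → ℝ → ℝ) (γm γp : ℝ → ℝ) : Prop :=
  RegSol R ρ ∧ (∀ t, q t ∈ Icc (0:ℝ) fmax) ∧ EntIneq R fmax f q ρ0 ρ ∧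
    LeftTraceAt ρ γm ∧ RightTraceAt ρ γp ∧
    (∀ᵐ t ∂(volume.restrict (Ioi (0:ℝ))), f (γm t) ≤ q t ∧ f (γp t) ≤ q t)

/-- Same as `CEI`, but on the time interval `[0,T)`. -/
def CEIOn (R fmax T : ℝ) (f q ρ0 : ℝ → ℝ) (ρ : ℝ → ℝ → ℝ) (γm γp : ℝ → ℝ) : Prop :=
  RegSol R ρ ∧ (∀ t, q t ∈ Icc (0:ℝ) fmax) ∧ EntIneqOn R fmax T f q ρ0 ρ ∧
    LeftTraceAt ρ γm ∧ RightTraceAt ρ γp ∧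
    (∀ᵐ t ∂(volume.restrict (Ioo (0:ℝ) T)), f (γm t) ≤ q t ∧ f (γp t) ≤ q t)

/-- The weighted average `ξ(t) = ∫_{ℝ₋} w x * ρ t x dx`. -/
def wAvg (w : ℝ → ℝ) (ρ : ℝ → ℝ → ℝ) (t : ℝ) : ℝ := ∫ x in Iic (0:ℝ), w x * ρ t x

/-- Entropy weak solution of the Cauchy problem with non-local point constraint given by
the (possibly multivalued, filled-in) piecewise constant `p`: there is a constraint level
`q` with `q t ∈ P(ξ(t)) = [p(ξ(t)+), p(ξ(t)−)]` a.e. such that `ρ` satisfies the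
constrained entropy inequalities with constraint level `q`. -/
def EWSol (R fmax : ℝ) (f w p ρ0 : ℝ → ℝ) (ρ : ℝ → ℝ → ℝ) (γm γp : ℝ → ℝ) : Prop :=
  ∃ q : ℝ → ℝ, CEI R fmax f q ρ0 ρ γm γp ∧
    ∀ᵐ t ∂(volume.restrict (Ioi (0:ℝ))),
      q t ∈ Icc (pplus R p (wAvg w ρ t)) (pminus p (wAvg w ρ t))

/-- Entropy weak solution with non-local constraint on the time interval `[0,T)`. -/
def EWSolOn (R fmax T : ℝ) (f w p ρ0 : ℝ → ℝ) (ρ : ℝ → ℝ → ℝ) (γm γp : ℝ → ℝ) : Prop :=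
  ∃ q : ℝ → ℝ, CEIOn R fmax T f q ρ0 ρ γm γp ∧
    ∀ᵐ t ∂(volume.restrict (Ioo (0:ℝ) T)),
      q t ∈ Icc (pplus R p (wAvg w ρ t)) (pminus p (wAvg w ρ t))

/-- The Riemann initial datum. -/
def riem (ρL ρR : ℝ) (x : ℝ) : ℝ := if x < 0 then ρL else ρR

/-- `ρ1 = ρ2` a.e. on `(0,T) × ℝ`. -/
def aeEqOn (T : ℝ) (ρ1 ρ2 : ℝ → ℝ → ℝ) : Prop :=
  ∀ᵐ z ∂((volume : Measure (ℝ × ℝ)).restrict (Ioo (0:ℝ) T ×ˢ (univ : Set ℝ))),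
    ρ1 z.1 z.2 = ρ2 z.1 z.2

/-- Self-similar entropy integrand. -/
def DD (g G : ℝ → ℝ) (k : ℝ) (χ χ' : ℝ → ℝ) (s : ℝ) : ℝ :=
  (Real.sign (G s - k) * (g (G s) - g k) - s * |G s - k|) * χ' s - |G s - k| * χ s

/-- A right half-fan with trace `b` at `0+` and far state `e`. -/
structure RFan (g : ℝ → ℝ) (b e : ℝ) (G : ℝ → ℝ) : Prop where
  meas : Measurable G
  cnt : {s | ¬ ContinuousAt G s}.Countable
  mem : ∀ s, G s ∈ uIcc b e
  far : ∃ C : ℝ, ∀ s, C < s → G s = e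
  tr : Tendsto G (nhdsWithin 0 (Ioi 0)) (nhds b)
  ent : ∀ (k : ℝ) (χ χ' : ℝ → ℝ), (∀ s, HasDerivAt χ (χ' s) s) → Continuous χ' →
    HasCompactSupport χ → (∀ s, 0 ≤ χ s) →
    -(Real.sign (b - k) * (g b - g k)) * χ 0 ≤ ∫ s in Ioi (0:ℝ), DD g G k χ χ' s

lemma measurable_rsign : Measurable Real.sign := by
  unfold Real.sign
  exact Measurable.ite measurableSet_Iio measurable_const
    (Measurable.ite measurableSet_Ioi measurable_const measurable_const)

lemma abs_rsign_le (x : ℝ) : |Real.sign x| ≤ 1 := by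
  rcases Real.sign_apply_eq x with h | h | h <;> simp [h]

lemma compactSupport_deriv {χ χ' : ℝ → ℝ} (h : ∀ s, HasDerivAt χ (χ' s) s)
    (hc : HasCompactSupport χ) : HasCompactSupport χ' := by
  have : χ' = deriv χ := funext fun s => ((h s).deriv).symm
  rw [this]; exact hc.deriv

lemma DD_integrable {g G : ℝ → ℝ} {a b : ℝ} (hg : Continuous g) (hG : Measurable G)
    (hm : ∀ s, G s ∈ Icc a b) (k : ℝ) {χ χ' : ℝ → ℝ} (h : ∀ s, HasDerivAt χ (χ' s) s)
    (hχ' : Continuous χ') (hc : HasCompactSupport χ) : Integrable (DD g G k χ χ') := by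
  have hc' := compactSupport_deriv h hc
  have hχ : Continuous χ := continuous_iff_continuousAt.2 fun s => (h s).continuousAt
  obtain ⟨C1, hC1⟩ := (isCompact_Icc (a := a) (b := b)).exists_bound_of_continuousOn
    (f := fun x => g x - g k) (by fun_prop)
  obtain ⟨C2, hC2⟩ := (isCompact_Icc (a := a) (b := b)).exists_bound_of_continuousOn
    (f := fun x => |x - k|) (by fun_prop)
  have i1 : Integrable (fun s => (Real.sign (G s - k) * (g (G s) - g k)) * χ' s) := by
    refine Integrable.bdd_mul (c := C1) (hχ'.integrable_of_hasCompactSupport hc') ?_ ?_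
    · exact ((measurable_rsign.comp (hG.sub_const k)).mul
        ((hg.measurable.comp hG).sub_const _)).aestronglyMeasurable
    · refine Eventually.of_forall fun s => ?_
      have h1 := abs_rsign_le (G s - k)
      have h2 := hC1 _ (hm s)
      rw [norm_mul, Real.norm_eq_abs, Real.norm_eq_abs]
      rw [Real.norm_eq_abs] at h2
      nlinarith [abs_nonneg (g (G s) - g k)]
  have hme : AEStronglyMeasurable (fun s => |G s - k|) volume := by
    exact (continuous_abs.measurable.comp (hG.sub_const k)).aestronglyMeasurable
  have i2 : Integrable (fun s => |G s - k| * (s * χ' s)) := by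
    refine Integrable.bdd_mul (c := C2) ?_ hme (Eventually.of_forall fun s => hC2 _ (hm s))
    exact (continuous_id.mul hχ').integrable_of_hasCompactSupport hc'.mul_left
  have i3 : Integrable (fun s => |G s - k| * χ s) :=
    Integrable.bdd_mul (c := C2) (hχ.integrable_of_hasCompactSupport hc) hme
      (Eventually.of_forall fun s => hC2 _ (hm s))
  refine ((i1.sub i2).sub i3).congr (Eventually.of_forall fun s => ?_)
  simp only [DD, Pi.sub_apply]; ring

/-- Existence of the right half-fan through maximisation. -/
lemma fan_max {g : ℝ → ℝ} {K : NNReal} (hg : LipschitzWith K g) {a b : ℝ} (hab : a ≤ b)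
    (hb : ∀ m ∈ Ico a b, g m < g b) : ∃ G, RFan g b a G := by
  have hgc := hg.continuous
  have hex : ∀ s : ℝ, ∃ x ∈ Icc a b, ∀ m ∈ Icc a b, g m - s * m ≤ g x - s * x := by
    intro s
    obtain ⟨x, hx, h⟩ := (isCompact_Icc (a := a) (b := b)).exists_isMaxOn
      (nonempty_Icc.2 hab) (f := fun m => g m - s * m) (by fun_prop)
    exact ⟨x, hx, fun m hm => h hm⟩
  choose G hGm hG using hex
  have hanti : Antitone G := by
    intro s t hst
    by_contra! hlt
    have h1 := hG s _ (hGm t)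
    have h2 := hG t _ (hGm s)
    rcases hst.eq_or_lt with rfl | hst
    · exact lt_irrefl _ hlt
    · nlinarith
  have hmeas := hanti.measurable
  have hcnt := hanti.countable_not_continuousAt
  have hfar : ∀ s, (K:ℝ) < s → G s = a := by
    intro s hs
    by_contra hne
    have hlt : a < G s := lt_of_le_of_ne (hGm s).1 (Ne.symm hne)
    have h1 := hG s a ⟨le_rfl, hab⟩
    have h2 := hg.dist_le_mul (G s) a
    rw [Real.dist_eq, Real.dist_eq, abs_of_pos (sub_pos.2 hlt)] at h2
    have := le_abs_self (g (G s) - g a)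
    nlinarith
  have hG0 : G 0 = b := by
    by_contra hne
    have := hb _ ⟨(hGm 0).1, lt_of_le_of_ne (hGm 0).2 hne⟩
    have h1 := hG 0 b ⟨hab, le_rfl⟩
    simp at h1; linarith
  have htr : Tendsto G (nhdsWithin 0 (Ioi 0)) (nhds b) := by
    have h := hanti.tendsto_nhdsGT 0
    set l := sSup (G '' Ioi 0)
    have hl : l ∈ Icc a b := isClosed_Icc.mem_of_tendsto h (Eventually.of_forall hGm)
    have h0 : Tendsto (fun s : ℝ => s) (nhdsWithin 0 (Ioi 0)) (nhds 0) :=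
      tendsto_nhdsWithin_of_tendsto_nhds tendsto_id
    have h1 : Tendsto (fun s => g (G s) - s * G s) (nhdsWithin 0 (Ioi 0)) (nhds (g l - 0 * l)) :=
      ((hgc.tendsto l).comp h).sub (h0.mul h)
    have h2 : Tendsto (fun s => g b - s * b) (nhdsWithin 0 (Ioi 0)) (nhds (g b - 0 * b)) :=
      tendsto_const_nhds.sub (h0.mul tendsto_const_nhds)
    have h3 := le_of_tendsto_of_tendsto' h2 h1 (fun s => hG s b ⟨hab, le_rfl⟩)
    have : l = b := by
      by_contra hne
      have := hb _ ⟨hl.1, lt_of_le_of_ne hl.2 hne⟩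
      simp at h3; linarith
    rwa [this] at h
  set h : ℝ → ℝ := fun s => g (G s) - s * G s with hh
  have hle : ∀ s t, h s - G s * (t - s) ≤ h t := by
    intro s t
    have := hG t _ (hGm s)
    simp only [hh]; linarith
  have hder : ∀ s, ContinuousAt G s → HasDerivAt h (-G s) s := by
    intro s hs
    rw [hasDerivAt_iff_isLittleO]
    rw [Asymptotics.isLittleO_iff]
    intro c hc
    have : ∀ᶠ t in nhds s, |G t - G s| < c := by
      have := Metric.tendsto_nhds.1 hs c hc
      simpa [Real.dist_eq] using this
    filter_upwards [this] with t ht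
    have e1 := hle s t
    have e2 := hle t s
    rw [Real.norm_eq_abs, Real.norm_eq_abs, smul_eq_mul]
    have e3 : 0 ≤ h t - h s - (t - s) * -G s := by linarith
    have e4 : h t - h s - (t - s) * -G s ≤ (G s - G t) * (t - s) := by linarith
    rw [abs_of_nonneg e3]
    refine e4.trans ((le_abs_self _).trans ?_)
    rw [abs_mul, abs_sub_comm (G s)]
    gcongr
  have hcont : Continuous h := by
    set M := max |a| |b|
    have hGM : ∀ s, |G s| ≤ M := fun s => abs_le_max_abs_abs (hGm s).1 (hGm s).2
    have : LipschitzWith (Real.toNNReal M) h := by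
      refine LipschitzWith.of_le_add_mul _ fun s t => ?_
      rw [Real.coe_toNNReal _ ((abs_nonneg a).trans (le_max_left _ _))]
      have e1 := hle s t
      have e2 : G s * (t - s) ≤ M * dist s t := by
        rw [dist_comm, Real.dist_eq]
        refine (le_abs_self _).trans ?_
        rw [abs_mul]
        gcongr
        exact hGM s
      linarith
    exact this.continuous
  refine ⟨G, hmeas, hcnt, fun s => by rw [uIcc_of_ge hab]; exact hGm s, ⟨K, hfar⟩, htr, ?_⟩
  intro k χ χ' hχ hχ' hcs hpos
  have hDint := DD_integrable hgc hmeas hGm k hχ hχ' hcs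
  have hχc : Continuous χ := continuous_iff_continuousAt.2 fun s => (hχ s).continuousAt
  have hcs' := compactSupport_deriv hχ hcs
  set v : ℝ → ℝ := fun s => (h s - (g k - s * k)) * χ s with hv
  set v' : ℝ → ℝ := fun s => (k - G s) * χ s + (h s - (g k - s * k)) * χ' s with hv'
  have hvc : Continuous v := by fun_prop
  have hvd : ∀ s, ContinuousAt G s → HasDerivAt v (v' s) s := by
    intro s hs
    have := ((hder s hs).sub ((hasDerivAt_const s (g k)).sub
      ((hasDerivAt_id s).mul_const k))).mul (hχ s)
    refine HasDerivAt.congr_deriv this ?_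
    simp only [v', Pi.sub_apply, id]; ring
  -- pointwise formulas
  have hD1 : ∀ s, k < G s → DD g G k χ χ' s = v' s := by
    intro s hs
    have h0 : 0 < G s - k := sub_pos.2 hs
    simp only [DD, Real.sign_of_pos h0, abs_of_pos h0, hv', hh]; ring
  have hD2 : ∀ s, G s ≤ k → DD g G k χ χ' s = - v' s := by
    intro s hs
    rcases hs.eq_or_lt with h0 | h0
    · simp [DD, hv', hh, h0]
    · have h0 : G s - k < 0 := sub_neg.2 h0
      simp only [DD, Real.sign_of_neg h0, abs_of_neg h0, hv', hh]; ring
  -- cutoff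
  obtain ⟨N, hN0, hN⟩ : ∃ N : ℝ, 0 < N ∧ ∀ s, N ≤ s → χ s = 0 ∧ χ' s = 0 := by
    obtain ⟨N, hN⟩ := (hcs.isCompact.union hcs'.isCompact).isBounded.subset_closedBall 0
    refine ⟨max N 0 + 1, by positivity, fun s hs => ?_⟩
    have hns : s ∉ tsupport χ ∪ tsupport χ' := by
      intro hmem
      have := hN hmem
      rw [Metric.mem_closedBall, Real.dist_eq, sub_zero] at this
      have h1 := le_abs_self s
      have h2 := le_max_left N 0
      linarith
    rw [mem_union, not_or] at hns
    exact ⟨image_eq_zero_of_notMem_tsupport hns.1, image_eq_zero_of_notMem_tsupport hns.2⟩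
  have hDN : ∀ s, N ≤ s → DD g G k χ χ' s = 0 := by
    intro s hs; simp [DD, hN s hs]
  have hJ : ∀ M, N ≤ M → ∫ s in Ioi (0:ℝ), DD g G k χ χ' s = ∫ s in (0:ℝ)..M, DD g G k χ χ' s := by
    intro M hM
    rw [intervalIntegral.integral_of_le (hN0.le.trans hM)]
    refine setIntegral_eq_of_subset_of_forall_sdiff_eq_zero measurableSet_Ioi
      (fun x hx => hx.1) fun x hx => ?_
    refine hDN x ?_
    by_contra! hlt
    exact hx.2 ⟨hx.1, (hlt.trans_le hM).le⟩
  have hvN : ∀ s, N ≤ s → v s = 0 := by intro s hs; simp [hv, hN s hs]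
  have hv0 : v 0 = (g b - g k) * χ 0 := by simp [hv, hh, hG0]
  -- piecewise integrals
  have hP1 : ∀ x y, x ≤ y → (∀ s ∈ Ioo x y, k < G s) →
      ∫ s in x..y, DD g G k χ χ' s = v y - v x := by
    intro x y hxy hs
    refine integral_eq_of_hasDerivAt_off_countable_of_le v _ hxy hcnt hvc.continuousOn ?_
      hDint.intervalIntegrable
    rintro s ⟨hs1, hs2⟩
    rw [hD1 s (hs s hs1)]
    exact hvd s (not_not.1 hs2)
  have hP2 : ∀ x y, x ≤ y → (∀ s ∈ Ioo x y, G s ≤ k) →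
      ∫ s in x..y, DD g G k χ χ' s = -v y - -v x := by
    intro x y hxy hs
    refine integral_eq_of_hasDerivAt_off_countable_of_le (fun s => -v s) _ hxy hcnt
      hvc.neg.continuousOn ?_ hDint.intervalIntegrable
    rintro s ⟨hs1, hs2⟩
    rw [hD2 s (hs s hs1)]
    exact (hvd s (not_not.1 hs2)).neg
  rcases lt_or_ge k a with hka | hka
  · rw [hJ N le_rfl, hP1 0 N hN0.le (fun s _ => hka.trans_le (hGm s).1), hvN N le_rfl, hv0,
      Real.sign_of_pos (by linarith)]
    linarith
  rcases lt_or_ge b k with hkb | hkb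
  · rw [hJ N le_rfl, hP2 0 N hN0.le (fun s _ => (hGm s).2.trans hkb.le), hvN N le_rfl, hv0,
      Real.sign_of_neg (by linarith)]
    linarith
  have hvpos : ∀ s, 0 ≤ v s := fun s =>
    mul_nonneg (by have := hG s k ⟨hka, hkb⟩; simp only [hh]; linarith) (hpos s)
  set S := insert (0:ℝ) {s | 0 < s ∧ k < G s} with hS
  have hSb : BddAbove S := by
    refine ⟨K, ?_⟩
    rintro s (rfl | ⟨hs1, hs2⟩)
    · exact K.2
    · by_contra! hlt
      rw [hfar s hlt] at hs2; linarith
  have hSne : S.Nonempty := ⟨0, mem_insert _ _⟩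
  set σ := sSup S with hσ
  have hσ0 : 0 ≤ σ := le_csSup hSb (mem_insert _ _)
  have h1 : ∀ s ∈ Ioo 0 σ, k < G s := by
    rintro s ⟨hs1, hs2⟩
    obtain ⟨r, hr, hsr⟩ := exists_lt_of_lt_csSup hSne hs2
    rcases hr with rfl | ⟨hr1, hr2⟩
    · linarith
    · exact hr2.trans_le (hanti hsr.le)
  have h2 : ∀ s ∈ Ioo σ (max σ N), G s ≤ k := by
    rintro s ⟨hs1, hs2⟩
    by_contra! hlt
    have := le_csSup hSb (mem_insert_of_mem (0:ℝ) (show s ∈ {s | 0 < s ∧ k < G s} from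
      ⟨hσ0.trans_lt hs1, hlt⟩))
    exact absurd hs1 (not_lt.2 this)
  rw [hJ (max σ N) (le_max_right _ _),
    ← intervalIntegral.integral_add_adjacent_intervals (b := σ) hDint.intervalIntegrable
      hDint.intervalIntegrable, hP1 0 σ hσ0 h1, hP2 σ _ (le_max_left _ _) h2,
      hvN _ (le_max_right _ _)]
  have h3 : -(Real.sign (b - k) * (g b - g k)) * χ 0 = - v 0 := by
    rw [hv0]
    rcases hkb.eq_or_lt with rfl | hlt
    · simp
    · rw [Real.sign_of_pos (by linarith)]; ring
  rw [h3]
  linarith [hvpos σ]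

/-- Reflected fan. -/
lemma fan_min {g : ℝ → ℝ} {K : NNReal} (hg : LipschitzWith K g) {b e : ℝ} (hbe : b ≤ e)
    (hb : ∀ m ∈ Ioc b e, g b < g m) : ∃ G, RFan g b e G := by
  have hg' : LipschitzWith K (fun n => - g (-n)) := by
    refine LipschitzWith.of_dist_le_mul fun x y => ?_
    have := hg.dist_le_mul (-x) (-y)
    rwa [dist_neg_neg] at this ⊢
  obtain ⟨G, hG⟩ := fan_max hg' (a := -e) (b := -b) (by linarith) (by
    intro m hm
    have := hb (-m) ⟨by linarith [hm.2], by linarith [hm.1]⟩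
    simpa using this)
  refine ⟨fun s => - G s, hG.meas.neg, ?_, ?_, ?_, ?_, ?_⟩
  · refine hG.cnt.mono fun s hs => ?_
    intro hc
    exact hs hc.neg
  · intro s
    have := hG.mem s
    rw [uIcc_of_ge (by linarith)] at this
    rw [uIcc_of_le hbe]
    exact ⟨by linarith [this.2], by linarith [this.1]⟩
  · obtain ⟨C, hC⟩ := hG.far
    exact ⟨C, fun s hs => by simp [hC s hs]⟩
  · simpa using hG.tr.neg
  · intro k χ χ' h1 h2 h3 h4
    have := hG.ent (-k) χ χ' h1 h2 h3 h4
    have hDD : ∀ s, DD (fun n => - g (-n)) G (-k) χ χ' s = DD g (fun s => - G s) k χ χ' s := by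
      intro s
      have e1 : G s - -k = -(-G s - k) := by ring
      simp only [DD]
      rw [e1, Real.sign_neg, abs_neg]
      simp only [neg_neg]; ring
    simp only [hDD] at this
    convert this using 1
    rw [show -b - -k = -(b - k) by ring, Real.sign_neg]
    simp only [neg_neg]; ring

/-- Self-similar function with profile `G`. -/
def sol (ρL ρR : ℝ) (G : ℝ → ℝ) (t x : ℝ) : ℝ := if t ≤ 0 then riem ρL ρR x else G (x / t)

/-- Basic properties of a self-similar profile. -/
structure SSim (R ρL ρR : ℝ) (G : ℝ → ℝ) : Prop where
  hL : ρL ∈ Icc (0:ℝ) R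
  hR : ρR ∈ Icc (0:ℝ) R
  meas : Measurable G
  cnt : {s | ¬ ContinuousAt G s}.Countable
  mem : ∀ s, G s ∈ Icc (0:ℝ) R
  far : ∃ C : ℝ, 0 < C ∧ (∀ s, s < -C → G s = ρL) ∧ (∀ s, C < s → G s = ρR)

lemma riem_meas (ρL ρR : ℝ) : Measurable (riem ρL ρR) :=
  Measurable.ite measurableSet_Iio measurable_const measurable_const

lemma SSim.sol_mem {R ρL ρR : ℝ} {G : ℝ → ℝ} (h : SSim R ρL ρR G) (t x : ℝ) :
    sol ρL ρR G t x ∈ Icc (0:ℝ) R := by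
  unfold sol riem
  split_ifs
  · exact h.hL
  · exact h.hR
  · exact h.mem _

lemma SSim.sol_meas {R ρL ρR : ℝ} {G : ℝ → ℝ} (h : SSim R ρL ρR G) :
    Measurable (Function.uncurry (sol ρL ρR G)) := by
  unfold sol Function.uncurry
  refine Measurable.ite (measurableSet_le measurable_fst measurable_const)
    ((riem_meas _ _).comp measurable_snd) (h.meas.comp (measurable_snd.div measurable_fst))

lemma SSim.sol_tendsto {R ρL ρR : ℝ} {G : ℝ → ℝ} (h : SSim R ρL ρR G) {s : ℝ} (hs : 0 ≤ s) :
    ∀ᵐ x : ℝ, Tendsto (fun t => sol ρL ρR G t x) (nhdsWithin s (Ici 0))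
      (nhds (sol ρL ρR G s x)) := by
  rcases hs.eq_or_lt with rfl | hs
  · obtain ⟨C, hC, hC1, hC2⟩ := h.far
    have h0 : ∀ᵐ x : ℝ, x ≠ 0 := by
      have := (countable_singleton (0:ℝ)).ae_notMem volume
      simpa using this
    filter_upwards [h0] with x hx
    refine tendsto_const_nhds.congr' ?_
    have hpos : 0 < |x| / C := by positivity
    filter_upwards [mem_nhdsWithin_of_mem_nhds (Iio_mem_nhds hpos)] with t ht
    unfold sol
    simp only [le_refl, if_true]
    split_ifs with h1
    · rfl
    · push Not at h1
      have ht' : t * C < |x| := (lt_div_iff₀ hC).1 ht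
      rcases lt_or_gt_of_ne hx with hx | hx
      · rw [abs_of_neg hx] at ht'
        rw [hC1 _ (by rw [div_lt_iff₀ h1]; linarith)]
        simp [riem, hx]
      · rw [abs_of_pos hx] at ht'
        rw [hC2 _ (by rw [lt_div_iff₀ h1]; linarith)]
        simp [riem, hx.le]
  · have h1 : {x : ℝ | ¬ ContinuousAt G (x / s)}.Countable := by
      refine (h.cnt.image (fun y => y * s)).mono fun x hx => ?_
      exact ⟨x / s, hx, by field_simp⟩
    filter_upwards [h1.ae_notMem volume] with x hx
    have hx : ContinuousAt G (x / s) := not_not.1 hx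
    refine tendsto_nhdsWithin_of_tendsto_nhds ?_
    have h2 : Tendsto (fun t => G (x / t)) (nhds s) (nhds (G (x / s))) :=
      hx.tendsto.comp (tendsto_const_nhds.div tendsto_id hs.ne')
    have h3 : sol ρL ρR G s x = G (x / s) := by simp [sol, not_le.2 hs]
    rw [h3]
    refine h2.congr' ?_
    filter_upwards [Ioi_mem_nhds hs] with t ht
    simp [sol, not_le.2 (show 0 < t from ht)]

lemma SSim.regSol {R ρL ρR : ℝ} {G : ℝ → ℝ} (h : SSim R ρL ρR G) :
    RegSol R (sol ρL ρR G) := by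
  refine ⟨h.sol_meas, h.sol_mem, fun r _ s hs => ?_⟩
  have hz : (0:ℝ) = ∫ x in Icc (-r) r, (0:ℝ) := by simp
  rw [hz]
  refine tendsto_integral_filter_of_dominated_convergence (fun _ => R) ?_ ?_ ?_ ?_
  · refine Eventually.of_forall fun t => Measurable.aestronglyMeasurable ?_
    have h1 : Measurable (fun x => sol ρL ρR G t x) := h.sol_meas.of_uncurry_left
    have h2 : Measurable (fun x => sol ρL ρR G s x) := h.sol_meas.of_uncurry_left
    exact continuous_abs.measurable.comp (h1.sub h2)
  · refine Eventually.of_forall fun t => Eventually.of_forall fun x => ?_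
    rw [Real.norm_eq_abs, abs_abs, abs_le]
    have h1 := h.sol_mem t x
    have h2 := h.sol_mem s x
    exact ⟨by linarith [h1.1, h2.2], by linarith [h1.2, h2.1]⟩
  · exact integrable_const R
  · filter_upwards [ae_restrict_of_ae (h.sol_tendsto hs)] with x hx
    have := (hx.sub (tendsto_const_nhds (x := sol ρL ρR G s x))).abs
    simpa using this

lemma testFn_data {φ : ℝ × ℝ → ℝ} (hφ : TestFn φ) :
    ∃ M C : ℝ, 0 < M ∧ 0 ≤ C ∧ (∀ t x, M ≤ |t| ∨ M ≤ |x| →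
      φ (t, x) = 0 ∧ pdT φ (t, x) = 0 ∧ pdX φ (t, x) = 0) ∧
      (∀ z, |φ z| ≤ C ∧ |pdT φ z| ≤ C ∧ |pdX φ z| ≤ C) ∧
      Continuous (pdT φ) ∧ Continuous (pdX φ) := by
  obtain ⟨hs, hc⟩ := hφ
  have hfc : Continuous (fderiv ℝ φ) := hs.continuous_fderiv (by simp)
  have hT : Continuous (pdT φ) := by unfold pdT; fun_prop
  have hX : Continuous (pdX φ) := by unfold pdX; fun_prop
  have hdc : HasCompactSupport (fderiv ℝ φ) := hc.fderiv ℝ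
  have hTc : HasCompactSupport (pdT φ) := hc.fderiv_apply ℝ _
  have hXc : HasCompactSupport (pdX φ) := hc.fderiv_apply ℝ _
  obtain ⟨N, hN⟩ := (hc.isCompact.union (hTc.isCompact.union
    hXc.isCompact)).isBounded.subset_closedBall 0
  obtain ⟨C0, hC0⟩ := hc.exists_bound_of_continuous hs.continuous
  obtain ⟨C1, hC1⟩ := hTc.exists_bound_of_continuous hT
  obtain ⟨C2, hC2⟩ := hXc.exists_bound_of_continuous hX
  refine ⟨max N 0 + 1, max C0 (max C1 C2), by positivity, ?_, ?_, ?_, hT, hX⟩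
  · exact ((norm_nonneg _).trans (hC0 0)).trans (le_max_left _ _)
  · intro t x h
    have hns : (t, x) ∉ tsupport φ ∪ (tsupport (pdT φ) ∪ tsupport (pdX φ)) := by
      intro hm
      have := hN hm
      rw [Metric.mem_closedBall, dist_zero_right, Prod.norm_def] at this
      simp only [Real.norm_eq_abs] at this
      have h1 := (le_max_left _ _).trans this
      have h2 := (le_max_right _ _).trans this
      have h3 := le_max_left N 0
      rcases h with h | h <;> linarith
    simp only [mem_union, not_or] at hns
    exact ⟨image_eq_zero_of_notMem_tsupport hns.1, image_eq_zero_of_notMem_tsupport hns.2.1,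
      image_eq_zero_of_notMem_tsupport hns.2.2⟩
  · intro z
    exact ⟨(hC0 z).trans (le_max_left _ _),
      (hC1 z).trans ((le_max_left _ _).trans (le_max_right _ _)),
      (hC2 z).trans ((le_max_right _ _).trans (le_max_right _ _))⟩

lemma hasDerivAt_ts {φ : ℝ × ℝ → ℝ} (hφ : TestFn φ) (t s : ℝ) :
    HasDerivAt (fun t => φ (t, t * s)) (pdT φ (t, t * s) + s * pdX φ (t, t * s)) t := by
  have hd : HasFDerivAt φ (fderiv ℝ φ (t, t * s)) (t, t * s) :=
    (hφ.1.differentiable (by simp) _).hasFDerivAt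
  have hc : HasDerivAt (fun t : ℝ => (t, t * s)) (1, s) t := by
    have := (hasDerivAt_id t).prodMk ((hasDerivAt_id t).mul_const s)
    simpa using this
  have := hd.comp_hasDerivAt t hc
  refine HasDerivAt.congr_deriv this ?_
  have e : ((1, s) : ℝ × ℝ) = (1, 0) + s • (0, 1) := by ext <;> simp
  rw [e, map_add, map_smul]; rfl

lemma hasDerivAt_s {φ : ℝ × ℝ → ℝ} (hφ : TestFn φ) (t s : ℝ) :
    HasDerivAt (fun s => φ (t, t * s)) (t * pdX φ (t, t * s)) s := by
  have hd : HasFDerivAt φ (fderiv ℝ φ (t, t * s)) (t, t * s) :=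
    (hφ.1.differentiable (by simp) _).hasFDerivAt
  have hc : HasDerivAt (fun s : ℝ => (t, t * s)) (0, t) s := by
    have := (hasDerivAt_const s t).prodMk ((hasDerivAt_id s).const_mul t)
    simpa using this
  have := hd.comp_hasDerivAt s hc
  refine HasDerivAt.congr_deriv this ?_
  have e : ((0, t) : ℝ × ℝ) = t • (0, 1) := by ext <;> simp
  rw [e, map_smul]; rfl

lemma ent_of_fan {g : ℝ → ℝ} (hg : Continuous g) {R fmax c ρL ρR : ℝ} {G : ℝ → ℝ}
    (hS : SSim R ρL ρR G)
    (h1d : ∀ k ∈ Icc (0:ℝ) R, ∀ χ χ' : ℝ → ℝ, (∀ s, HasDerivAt χ (χ' s) s) → Continuous χ' →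
      HasCompactSupport χ → (∀ s, 0 ≤ χ s) →
      0 ≤ (∫ s, DD g G k χ χ' s) + 2 * ((1 - c / fmax) * g k) * χ 0) :
    EntIneq R fmax g (fun _ => c) (riem ρL ρR) (sol ρL ρR G) := by
  intro φ hφ hpos k hk
  obtain ⟨M, C, hM, hC0, hsup, hbd, hTc, hXc⟩ := testFn_data hφ
  have hφc : Continuous φ := hφ.1.continuous
  have hηb : ∀ r ∈ Icc (0:ℝ) R, |r - k| ≤ R := by
    intro r hr
    rw [abs_le]; exact ⟨by linarith [hr.1, hk.2], by linarith [hr.2, hk.1]⟩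
  have hR0 : 0 ≤ R := hk.1.trans hk.2
  have hmt : ∀ t, Measurable (fun x => sol ρL ρR G t x) := fun t => hS.sol_meas.of_uncurry_left
  set A : ℝ → ℝ := fun t => ∫ x, |sol ρL ρR G t x - k| * φ (t, x) with hA
  set X : ℝ → ℝ := fun t => ∫ x, (|sol ρL ρR G t x - k| * pdT φ (t, x) +
            Real.sign (sol ρL ρR G t x - k) * (g (sol ρL ρR G t x) - g k) * pdX φ (t, x)) with hX
  -- continuity of A
  have hAc : ∀ s, 0 ≤ s → ContinuousWithinAt A (Ici 0) s := by
    intro s hs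
    refine continuousWithinAt_of_dominated
      (bound := indicator (Icc (-M) M) (fun _ => R * C)) ?_ ?_ ?_ ?_
    · refine Eventually.of_forall fun t => Measurable.aestronglyMeasurable ?_
      exact (continuous_abs.measurable.comp ((hmt t).sub_const k)).mul
        (hφc.comp (by fun_prop : Continuous fun x : ℝ => (t, x))).measurable
    · refine Eventually.of_forall fun t => Eventually.of_forall fun x => ?_
      by_cases hx : x ∈ Icc (-M) M
      · rw [indicator_of_mem hx, norm_mul, Real.norm_eq_abs, abs_abs, Real.norm_eq_abs]
        exact mul_le_mul (hηb _ (hS.sol_mem t x)) (hbd _).1 (abs_nonneg _) hR0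
      · rw [indicator_of_notMem hx, (hsup t x (Or.inr ?_)).1]
        · simp
        · by_contra! hlt
          exact hx (abs_le.1 hlt.le)
    · exact (integrable_indicator_iff measurableSet_Icc).2 (integrableOn_const (by simp))
    · filter_upwards [hS.sol_tendsto hs] with x hx
      have h2 : ContinuousWithinAt (fun t => φ (t, x)) (Ici 0) s :=
        (hφc.comp (by fun_prop : Continuous fun t : ℝ => (t, x))).continuousWithinAt
      exact ((hx.sub_const k).abs).mul h2
  have hA0 : A 0 = ∫ x : ℝ, |riem ρL ρR x - k| * φ (0, x) := by simp [hA, sol]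
  have hAM : A M = 0 := by
    have : ∀ x, |sol ρL ρR G M x - k| * φ (M, x) = 0 := fun x => by
      rw [(hsup M x (Or.inl (le_abs_self M))).1, mul_zero]
    simp [hA, this]
  -- derivative of A
  have hder : ∀ t, 0 < t → ∃ A', HasDerivAt A A' t ∧
      A' ≤ X t + 2 * ((1 - c / fmax) * g k) * φ (t, 0) := by
    intro t0 ht0
    set B : ℝ → ℝ := fun t => ∫ s, |G s - k| * φ (t, t * s) with hB
    have hAB : ∀ t, 0 < t → A t = t * B t := by
      intro t ht
      have := Measure.integral_comp_mul_left (fun x => |G (x / t) - k| * φ (t, x)) t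
      simp only [mul_div_cancel_left₀ _ ht.ne'] at this
      simp only [hA, hB, sol, not_le.2 ht, if_false]
      rw [this, abs_of_pos (by positivity), smul_eq_mul]
      field_simp
    have hme : AEStronglyMeasurable (fun s => |G s - k|) volume :=
      (continuous_abs.measurable.comp (hS.meas.sub_const k)).aestronglyMeasurable
    have hz : ∀ s t, t0 / 2 < t → s ∉ Icc (-(2 * M / t0)) (2 * M / t0) → M ≤ |t * s| := by
      intro s t ht hs
      have h1 : 2 * M / t0 < |s| := by
        by_contra! hle
        exact hs (abs_le.1 hle)
      rw [div_lt_iff₀ ht0] at h1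
      rw [abs_mul, abs_of_pos (by linarith)]
      nlinarith [abs_nonneg s]
    have hBd := hasDerivAt_integral_of_dominated_loc_of_deriv_le (𝕜 := ℝ) (μ := volume)
      (bound := indicator (Icc (-(2 * M / t0)) (2 * M / t0)) (fun _ => R * (C + 2 * M / t0 * C)))
      (F := fun t s => |G s - k| * φ (t, t * s)) (x₀ := t0) (s := Ioi (t0 / 2))
      (F' := fun t s => |G s - k| * (pdT φ (t, t * s) + s * pdX φ (t, t * s)))
      (Ioi_mem_nhds (by linarith))
      (Eventually.of_forall fun t => hme.mul
        (hφc.comp (by fun_prop : Continuous fun s : ℝ => (t, t * s))).aestronglyMeasurable)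
      (by
        refine Integrable.bdd_mul (c := R) ?_ hme (Eventually.of_forall fun s => ?_)
        · refine Continuous.integrable_of_hasCompactSupport
            (hφc.comp (by fun_prop : Continuous fun s : ℝ => (t0, t0 * s))) ?_
          refine HasCompactSupport.intro (K := Icc (-(2 * M / t0)) (2 * M / t0)) isCompact_Icc ?_
          intro s hs
          exact (hsup t0 _ (Or.inr (hz s t0 (by linarith) hs))).1
        · rw [Real.norm_eq_abs, abs_abs]; exact hηb _ (hS.mem s))
      (hme.mul (Continuous.aestronglyMeasurable (by fun_prop)))
      (by
        refine Eventually.of_forall fun s t ht => ?_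
        by_cases hs : s ∈ Icc (-(2 * M / t0)) (2 * M / t0)
        · rw [indicator_of_mem hs, norm_mul, Real.norm_eq_abs, abs_abs, Real.norm_eq_abs]
          refine mul_le_mul (hηb _ (hS.mem s)) ?_ (abs_nonneg _) hR0
          refine (abs_add_le _ _).trans (add_le_add (hbd _).2.1 ?_)
          rw [abs_mul]
          exact mul_le_mul (abs_le.2 hs) (hbd _).2.2 (abs_nonneg _) (by positivity)
        · obtain ⟨-, h1, h2⟩ := hsup t _ (Or.inr (hz s t ht hs))
          rw [indicator_of_notMem hs, h1, h2]; simp)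
      ((integrable_indicator_iff measurableSet_Icc).2 (integrableOn_const (by simp)))
      (Eventually.of_forall fun s t _ => (hasDerivAt_ts hφ t s).const_mul _)
    obtain ⟨hI3, hBd⟩ := hBd
    set B' := ∫ s, |G s - k| * (pdT φ (t0, t0 * s) + s * pdX φ (t0, t0 * s)) with hB'
    have hAd : HasDerivAt A (1 * B t0 + t0 * B') t0 := by
      have h1 : HasDerivAt (fun t => t * B t) (1 * B t0 + t0 * B') t0 :=
        (hasDerivAt_id t0).mul hBd
      refine h1.congr_of_eventuallyEq ?_
      filter_upwards [Ioi_mem_nhds ht0] with t ht using hAB t ht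
    refine ⟨_, hAd, ?_⟩
    have hI2 : Integrable (fun s => |G s - k| * φ (t0, t0 * s)) := by
      refine Integrable.bdd_mul (c := R) ?_ hme (Eventually.of_forall fun s => ?_)
      · refine Continuous.integrable_of_hasCompactSupport
          (hφc.comp (by fun_prop : Continuous fun s : ℝ => (t0, t0 * s))) ?_
        refine HasCompactSupport.intro (K := Icc (-(2 * M / t0)) (2 * M / t0)) isCompact_Icc ?_
        intro s hs
        exact (hsup t0 _ (Or.inr (hz s t0 (by linarith) hs))).1
      · rw [Real.norm_eq_abs, abs_abs]; exact hηb _ (hS.mem s)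
    have hcs : HasCompactSupport (fun s => φ (t0, t0 * s)) := by
      refine HasCompactSupport.intro (K := Icc (-(2 * M / t0)) (2 * M / t0)) isCompact_Icc ?_
      intro s hs
      exact (hsup t0 _ (Or.inr (hz s t0 (by linarith) hs))).1
    have hχ'c : Continuous (fun s => t0 * pdX φ (t0, t0 * s)) := by fun_prop
    have hDi := DD_integrable hg hS.meas hS.mem k (hasDerivAt_s hφ t0) hχ'c hcs
    have hD := h1d k hk _ _ (hasDerivAt_s hφ t0) hχ'c hcs (fun s => hpos _)
    simp only [mul_zero] at hD
    have hXt : X t0 = (∫ s, DD g G k (fun s => φ (t0, t0 * s)) (fun s => t0 * pdX φ (t0, t0 * s)) s)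
        + B t0 + t0 * B' := by
      have := Measure.integral_comp_mul_left (fun x => |G (x / t0) - k| * pdT φ (t0, x) +
            Real.sign (G (x / t0) - k) * (g (G (x / t0)) - g k) * pdX φ (t0, x)) t0
      simp only [mul_div_cancel_left₀ _ ht0.ne'] at this
      rw [abs_of_pos (by positivity), smul_eq_mul, eq_comm, inv_mul_eq_iff_eq_mul₀ ht0.ne'] at this
      simp only [hX, sol, not_le.2 ht0, if_false]
      have hsum : Integrable (fun s => DD g G k (fun s => φ (t0, t0 * s))
        (fun s => t0 * pdX φ (t0, t0 * s)) s + |G s - k| * φ (t0, t0 * s)) := hDi.add hI2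
      rw [this, hB, hB', ← integral_const_mul, ← integral_const_mul, ← integral_add hDi hI2,
        ← integral_add hsum (hI3.const_mul t0)]
      refine integral_congr_ae (Eventually.of_forall fun s => ?_)
      simp only [DD]; ring
    rw [hXt]; linarith
  choose! A' hA' hA'le using hder
  -- integrability of X
  have hXi : Integrable X := by
    have : Integrable (fun z : ℝ × ℝ => |sol ρL ρR G z.1 z.2 - k| * pdT φ z +
            Real.sign (sol ρL ρR G z.1 z.2 - k) * (g (sol ρL ρR G z.1 z.2) - g k) * pdX φ z)
            ((volume : Measure ℝ).prod volume) := by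
      obtain ⟨C1, hC1⟩ := (isCompact_Icc (a := (0:ℝ)) (b := R)).exists_bound_of_continuousOn
        (f := fun x => g x - g k) (by fun_prop)
      have hm : Measurable (fun z : ℝ × ℝ => sol ρL ρR G z.1 z.2) := hS.sol_meas
      have hcT : HasCompactSupport (pdT φ) := hφ.2.fderiv_apply ℝ _
      have hcX : HasCompactSupport (pdX φ) := hφ.2.fderiv_apply ℝ _
      refine Integrable.add ?_ ?_
      · refine Integrable.bdd_mul (c := R) (hTc.integrable_of_hasCompactSupport hcT)
          (continuous_abs.measurable.comp (hm.sub_const k)).aestronglyMeasurable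
          (Eventually.of_forall fun z => ?_)
        rw [Real.norm_eq_abs, abs_abs]; exact hηb _ (hS.sol_mem _ _)
      · refine Integrable.bdd_mul (c := C1) (hXc.integrable_of_hasCompactSupport hcX)
          ((measurable_rsign.comp (hm.sub_const k)).mul
            ((hg.measurable.comp hm).sub_const _)).aestronglyMeasurable
          (Eventually.of_forall fun z => ?_)
        have h1 := abs_rsign_le (sol ρL ρR G z.1 z.2 - k)
        have h2 := hC1 _ (hS.sol_mem z.1 z.2)
        rw [norm_mul, Real.norm_eq_abs, Real.norm_eq_abs]
        rw [Real.norm_eq_abs] at h2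
        nlinarith [abs_nonneg (g (sol ρL ρR G z.1 z.2) - g k)]
    exact this.integral_prod_left
  have hφ0c : Continuous (fun t : ℝ => φ (t, 0)) := by fun_prop
  have hφ0i : Integrable (fun t : ℝ => φ (t, 0)) := by
    refine hφ0c.integrable_of_hasCompactSupport
      (HasCompactSupport.intro (K := Icc (-M) M) isCompact_Icc fun t ht => ?_)
    refine (hsup t 0 (Or.inl ?_)).1
    by_contra! hlt
    exact ht (abs_le.1 hlt.le)
  have key := intervalIntegral.sub_le_integral_of_hasDeriv_right_of_le (a := 0) (b := M)
    (g := A) (g' := A') (φ := fun t => X t + 2 * ((1 - c / fmax) * g k) * φ (t, 0)) hM.le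
    (fun s hs => (hAc s hs.1).mono Icc_subset_Ici_self)
    (fun t ht => (hA' t ht.1).hasDerivWithinAt)
    ((hXi.add (hφ0i.const_mul _)).integrableOn)
    (fun t ht => hA'le t ht.1)
  rw [intervalIntegral.integral_add hXi.intervalIntegrable
    (hφ0i.const_mul _).intervalIntegrable, hAM, hA0] at key
  have e1 : ∫ t in Ioi (0:ℝ), X t = ∫ t in (0:ℝ)..M, X t := by
    rw [intervalIntegral.integral_of_le hM.le]
    refine setIntegral_eq_of_subset_of_forall_sdiff_eq_zero measurableSet_Ioi
      (fun x hx => hx.1) fun t ht => ?_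
    have hMt : M ≤ |t| := by
      by_contra! hlt
      exact ht.2 ⟨ht.1, (abs_le.1 hlt.le).2⟩
    have : ∀ x, |sol ρL ρR G t x - k| * pdT φ (t, x) +
            Real.sign (sol ρL ρR G t x - k) * (g (sol ρL ρR G t x) - g k) * pdX φ (t, x) = 0 := by
      intro x
      obtain ⟨-, h1, h2⟩ := hsup t x (Or.inl hMt)
      rw [h1, h2]; simp
    simp [hX, this]
  have e2 : 2 * (∫ t in Ioi (0:ℝ), (1 - c / fmax) * g k * φ (t, 0)) =
      ∫ t in (0:ℝ)..M, 2 * ((1 - c / fmax) * g k) * φ (t, 0) := by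
    rw [intervalIntegral.integral_of_le hM.le, integral_const_mul, integral_const_mul]
    have : ∫ t in Ioi (0:ℝ), φ (t, 0) = ∫ t in Ioc (0:ℝ) M, φ (t, 0) := by
      refine setIntegral_eq_of_subset_of_forall_sdiff_eq_zero measurableSet_Ioi
        (fun x hx => hx.1) fun t ht => ?_
      refine (hsup t 0 (Or.inl ?_)).1
      by_contra! hlt
      exact ht.2 ⟨ht.1, (abs_le.1 hlt.le).2⟩
    rw [this]; ring
  rw [e2, e1]
  linarith

lemma trace_aux {H : ℝ → ℝ} {b R : ℝ} (hm : Measurable H) (hR : ∀ s, |H s - b| ≤ R)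
    (htr : Tendsto H (nhdsWithin 0 (Ioi 0)) (nhds b)) {φ : ℝ × ℝ → ℝ} (hφ : Continuous φ)
    {M C : ℝ} (hsup : ∀ t x, M ≤ |t| → φ (t, x) = 0) (hC : ∀ z, |φ z| ≤ C) :
    Tendsto (fun ε : ℝ => (1 / ε) * ∫ t in Ioi (0:ℝ), ∫ x in Ioo (0:ℝ) ε,
        |H (x / t) - b| * φ (t, x)) (nhdsWithin 0 (Ioi 0)) (nhds 0) := by
  have hR0 : 0 ≤ R := (abs_nonneg _).trans (hR 0)
  have hC0 : 0 ≤ C := (abs_nonneg _).trans (hC 0)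
  have hb : ∀ s z, ‖|H s - b| * φ z‖ ≤ R * C := by
    intro s z
    rw [norm_mul, Real.norm_eq_abs, abs_abs, Real.norm_eq_abs]
    exact mul_le_mul (hR s) (hC z) (abs_nonneg _) hR0
  have heq : ∀ ε : ℝ, 0 < ε → (1 / ε) * ∫ t in Ioi (0:ℝ), ∫ x in Ioo (0:ℝ) ε,
        |H (x / t) - b| * φ (t, x) = ∫ t in Ioi (0:ℝ), ∫ y in Ioc (0:ℝ) 1,
        |H (ε * y / t) - b| * φ (t, ε * y) := by
    intro ε hε
    rw [← integral_const_mul]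
    refine integral_congr_ae (Eventually.of_forall fun t => ?_)
    have := intervalIntegral.integral_comp_mul_left (a := 0) (b := 1)
      (fun x => |H (x / t) - b| * φ (t, x)) hε.ne'
    rw [mul_zero, mul_one, intervalIntegral.integral_of_le zero_le_one,
      intervalIntegral.integral_of_le hε.le, smul_eq_mul] at this
    simp only
    rw [this, integral_Ioc_eq_integral_Ioo, one_div]
  have hz : (0:ℝ) = ∫ t in Ioi (0:ℝ), (0:ℝ) := by simp
  have hmain : Tendsto (fun ε : ℝ => ∫ t in Ioi (0:ℝ), ∫ y in Ioc (0:ℝ) 1,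
        |H (ε * y / t) - b| * φ (t, ε * y)) (nhdsWithin 0 (Ioi 0)) (nhds 0) := by
    conv => arg 3; rw [hz]
    refine tendsto_integral_filter_of_dominated_convergence
      (indicator (Icc (-M) M) (fun _ => R * C)) ?_ ?_ ?_ ?_
    · refine Eventually.of_forall fun ε => ?_
      have hme : Measurable (Function.uncurry fun t y : ℝ =>
          |H (ε * y / t) - b| * φ (t, ε * y)) := by
        refine Measurable.mul ?_ ?_
        · exact continuous_abs.measurable.comp
            ((hm.comp ((measurable_snd.const_mul ε).div measurable_fst)).sub_const b)
        · exact (hφ.comp (by fun_prop :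
            Continuous fun z : ℝ × ℝ => (z.1, ε * z.2))).measurable
      exact (hme.stronglyMeasurable.integral_prod_right).aestronglyMeasurable
    · refine Eventually.of_forall fun ε => Eventually.of_forall fun t => ?_
      by_cases ht : t ∈ Icc (-M) M
      · rw [indicator_of_mem ht]
        have := norm_setIntegral_le_of_norm_le_const (μ := volume) (s := Ioc (0:ℝ) 1)
          (f := fun y => |H (ε * y / t) - b| * φ (t, ε * y)) (C := R * C) (by simp)
          (fun y _ => hb _ _)
        simpa using this
      · have hMt : M ≤ |t| := by
          by_contra! hlt
          exact ht (abs_le.1 hlt.le)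
        rw [indicator_of_notMem ht]
        simp [hsup t _ hMt]
    · exact ((integrable_indicator_iff measurableSet_Icc).2
        (integrableOn_const (by simp))).integrableOn
    · refine (ae_restrict_iff' measurableSet_Ioi).2 (Eventually.of_forall fun t ht => ?_)
      have ht : (0:ℝ) < t := ht
      have hz : (0:ℝ) = ∫ y in Ioc (0:ℝ) 1, (0:ℝ) := by simp
      conv => arg 3; rw [hz]
      refine tendsto_integral_filter_of_dominated_convergence (fun _ => R * C) ?_ ?_ ?_ ?_
      · refine Eventually.of_forall fun ε => Measurable.aestronglyMeasurable ?_
        refine Measurable.mul ?_ ?_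
        · exact continuous_abs.measurable.comp
            ((hm.comp ((measurable_id.const_mul ε).div_const t)).sub_const b)
        · exact (hφ.comp (by fun_prop : Continuous fun y : ℝ => (t, ε * y))).measurable
      · exact Eventually.of_forall fun ε => Eventually.of_forall fun y => hb _ _
      · exact integrable_const _
      · refine (ae_restrict_iff' measurableSet_Ioc).2 (Eventually.of_forall fun y hy => ?_)
        have h1 : Tendsto (fun ε : ℝ => ε * y / t) (nhdsWithin 0 (Ioi 0))
            (nhdsWithin 0 (Ioi 0)) := by
          refine tendsto_nhdsWithin_iff.2 ⟨?_, ?_⟩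
          · have : Continuous (fun ε : ℝ => ε * y / t) := by fun_prop
            have := this.tendsto 0
            simp only [zero_mul, zero_div] at this
            exact tendsto_nhdsWithin_of_tendsto_nhds this
          · filter_upwards [self_mem_nhdsWithin] with ε hε
            exact div_pos (mul_pos hε hy.1) ht
        have h2 : Tendsto (fun ε : ℝ => |H (ε * y / t) - b|) (nhdsWithin 0 (Ioi 0)) (nhds 0) := by
          have := ((htr.comp h1).sub_const b).abs
          simpa using this
        refine squeeze_zero_norm (a := fun ε => |H (ε * y / t) - b| * C) (fun ε => ?_) ?_
        · rw [norm_mul, Real.norm_eq_abs, abs_abs]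
          exact mul_le_mul_of_nonneg_left (hC _) (abs_nonneg _)
        · simpa using h2.mul_const C
  refine hmain.congr' ?_
  filter_upwards [self_mem_nhdsWithin] with ε hε using (heq ε hε).symm

/-- Gluing two half-fans. -/
def glue (Gl Gr : ℝ → ℝ) (s : ℝ) : ℝ := if s < 0 then Gl (-s) else Gr s

lemma glue_neg (Gl Gr : ℝ → ℝ) {s : ℝ} (h : s < 0) : glue Gl Gr s = Gl (-s) := by
  simp [glue, h]

lemma glue_pos (Gl Gr : ℝ → ℝ) {s : ℝ} (h : 0 < s) : glue Gl Gr s = Gr s := by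
  simp [glue, h.le]

lemma glue_ssim {g : ℝ → ℝ} {R ρL ρR A B : ℝ} {Gl Gr : ℝ → ℝ}
    (hl : RFan (fun m => - g m) A ρL Gl) (hr : RFan g B ρR Gr)
    (hL : ρL ∈ Icc (0:ℝ) R) (hR : ρR ∈ Icc (0:ℝ) R) (hA : A ∈ Icc (0:ℝ) R)
    (hB : B ∈ Icc (0:ℝ) R) : SSim R ρL ρR (glue Gl Gr) := by
  refine ⟨hL, hR, ?_, ?_, ?_, ?_⟩
  · exact Measurable.ite measurableSet_Iio (hl.meas.comp measurable_neg) hr.meas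
  · refine (((hl.cnt.image (fun s => -s)).union hr.cnt).union (countable_singleton (0:ℝ))).mono ?_
    intro s hs
    by_contra hns
    simp only [mem_union, not_or] at hns
    obtain ⟨⟨h1, h2⟩, h3⟩ := hns
    have h2 : ContinuousAt Gr s := not_not.1 h2
    rcases lt_trichotomy s 0 with h | h | h
    · have h4 : ContinuousAt Gl (-s) := by
        by_contra hc
        exact h1 ⟨-s, hc, neg_neg s⟩
      refine hs ((h4.comp (f := fun s => -s) continuous_neg.continuousAt).congr ?_)
      filter_upwards [Iio_mem_nhds h] with r hr using (glue_neg Gl Gr hr).symm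
    · exact h3 h
    · refine hs (h2.congr ?_)
      filter_upwards [Ioi_mem_nhds h] with r hr using (glue_pos Gl Gr hr).symm
  · intro s
    unfold glue
    split_ifs
    · exact uIcc_subset_Icc hA hL (hl.mem _)
    · exact uIcc_subset_Icc hB hR (hr.mem _)
  · obtain ⟨C1, h1⟩ := hl.far
    obtain ⟨C2, h2⟩ := hr.far
    refine ⟨max (max C1 C2) 1, by positivity, fun s hs => ?_, fun s hs => ?_⟩
    · have e1 := le_max_left (max C1 C2) 1
      have e2 := le_max_right (max C1 C2) 1
      have e3 := le_max_left C1 C2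
      rw [glue_neg _ _ (by linarith)]
      exact h1 _ (by linarith)
    · have e1 := le_max_left (max C1 C2) 1
      have e2 := le_max_right (max C1 C2) 1
      have e3 := le_max_right C1 C2
      rw [glue_pos _ _ (by linarith)]
      exact h2 _ (by linarith)

lemma glue_ent {g : ℝ → ℝ} (hg : Continuous g) {R ρL ρR A B : ℝ} {Gl Gr : ℝ → ℝ}
    (hl : RFan (fun m => - g m) A ρL Gl) (hr : RFan g B ρR Gr)
    (hS : SSim R ρL ρR (glue Gl Gr)) (k : ℝ) (χ χ' : ℝ → ℝ)
    (h1 : ∀ s, HasDerivAt χ (χ' s) s) (h2 : Continuous χ')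
    (h3 : HasCompactSupport χ) (h4 : ∀ s, 0 ≤ χ s) :
    (Real.sign (A - k) * (g A - g k) - Real.sign (B - k) * (g B - g k)) * χ 0 ≤
      ∫ s, DD g (glue Gl Gr) k χ χ' s := by
  have hDint := DD_integrable hg hS.meas hS.mem k h1 h2 h3
  rw [← intervalIntegral.integral_Iic_add_Ioi (b := 0) hDint.integrableOn hDint.integrableOn]
  have e1 : ∫ s in Ioi (0:ℝ), DD g (glue Gl Gr) k χ χ' s = ∫ s in Ioi (0:ℝ), DD g Gr k χ χ' s := by
    refine setIntegral_congr_fun measurableSet_Ioi fun s hs => ?_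
    simp only [DD, glue_pos Gl Gr hs]
  have e2 : ∫ s in Iic (0:ℝ), DD g (glue Gl Gr) k χ χ' s =
      ∫ s in Ioi (0:ℝ), DD (fun m => - g m) Gl k (fun s => χ (-s)) (fun s => - χ' (-s)) s := by
    have := integral_comp_neg_Ioi 0 (DD g (glue Gl Gr) k χ χ')
    rw [neg_zero] at this
    rw [← this]
    refine setIntegral_congr_fun measurableSet_Ioi fun s hs => ?_
    have hs : -s < 0 := neg_lt_zero.2 hs
    simp only [DD, glue_neg Gl Gr hs, neg_neg]
    ring
  have i1 := hr.ent k χ χ' h1 h2 h3 h4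
  have i2 := hl.ent k (fun s => χ (-s)) (fun s => - χ' (-s)) (fun s => by
      have := (h1 (-s)).scomp s (hasDerivAt_neg s)
      simpa [Function.comp_def] using this) (by fun_prop)
      (h3.comp_homeomorph (Homeomorph.neg ℝ)) (fun s => h4 _)
  rw [e1, e2]
  simp only [neg_zero] at i2
  linarith

lemma build {f g : ℝ → ℝ} {R fmax c ρL ρR A B : ℝ} {Gl Gr : ℝ → ℝ}
    (hg : Continuous g) (hfg : EqOn f g (Icc 0 R))
    (hl : RFan (fun m => - g m) A ρL Gl) (hr : RFan g B ρR Gr)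
    (hL : ρL ∈ Icc (0:ℝ) R) (hR : ρR ∈ Icc (0:ℝ) R) (hA : A ∈ Icc (0:ℝ) R)
    (hB : B ∈ Icc (0:ℝ) R) (hLA : ρL ≤ A)
    (hcon : ∀ k ∈ Icc (0:ℝ) R, 0 ≤ Real.sign (A - k) * (f A - f k) -
      Real.sign (B - k) * (f B - f k) + 2 * ((1 - c / fmax) * f k)) :
    ∃ ρ : ℝ → ℝ → ℝ, RegSol R ρ ∧ EntIneq R fmax f (fun _ => c) (riem ρL ρR) ρ ∧
      LeftTraceAt ρ (fun _ => A) ∧ RightTraceAt ρ (fun _ => B) ∧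
      (∀ t > 0, ∀ x < 0, ρ t x ∈ Icc ρL A) ∧
      (∀ᵐ x : ℝ, x < 0 → Tendsto (fun t => ρ t x) (nhdsWithin 0 (Ioi 0)) (nhds ρL)) ∧
      (ρL < A → ∃ δ > 0, ∀ t > 0, ∀ x ∈ Ioo (-(δ * t)) 0, ρL < ρ t x) := by
  have hS := glue_ssim hl hr hL hR hA hB
  have hb : ∀ D ∈ Icc (0:ℝ) R, ∀ D' ∈ Icc (0:ℝ) R, |D' - D| ≤ R := by
    intro D hD D' hD'
    rw [abs_le]; exact ⟨by linarith [hD.2, hD'.1], by linarith [hD.1, hD'.2]⟩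
  refine ⟨sol ρL ρR (glue Gl Gr), hS.regSol, ?_, ?_, ?_, ?_, ?_, ?_⟩
  · have h := ent_of_fan (fmax := fmax) (c := c) hg hS (by
      intro k hk χ χ' h1 h2 h3 h4
      have e := glue_ent hg hl hr hS k χ χ' h1 h2 h3 h4
      have e2 := hcon k hk
      rw [hfg hA, hfg hB, hfg hk] at e2
      have e3 := mul_nonneg e2 (h4 0)
      linarith)
    intro φ hφ hpos k hk
    have := h φ hφ hpos k hk
    have hf : ∀ t x, f (sol ρL ρR (glue Gl Gr) t x) = g (sol ρL ρR (glue Gl Gr) t x) :=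
      fun t x => hfg (hS.sol_mem t x)
    simp only [hf, hfg hk]
    exact this
  · intro φ hφ
    obtain ⟨M, C, hM, hC0, hsup, hbd, hTc, hXc⟩ := testFn_data hφ
    have h := trace_aux (b := A) (R := R) hl.meas
      (fun s => hb _ hA _ (uIcc_subset_Icc hA hL (hl.mem s))) hl.tr
      (φ := fun z => φ (z.1, -z.2)) (hφ.1.continuous.comp (by fun_prop))
      (M := M) (C := C) (fun t x h => (hsup t (-x) (Or.inl h)).1) (fun z => (hbd _).1)
    refine h.congr' ?_
    filter_upwards [self_mem_nhdsWithin] with ε hε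
    have hε : (0:ℝ) < ε := hε
    congr 1
    refine setIntegral_congr_fun measurableSet_Ioi fun t ht => ?_
    have ht : (0:ℝ) < t := ht
    have e := intervalIntegral.integral_comp_neg (a := 0) (b := ε)
      (fun x => |sol ρL ρR (glue Gl Gr) t x - A| * φ (t, x))
    rw [neg_zero, intervalIntegral.integral_of_le hε.le,
      intervalIntegral.integral_of_le (by linarith), integral_Ioc_eq_integral_Ioo,
      integral_Ioc_eq_integral_Ioo] at e
    rw [← e]
    refine setIntegral_congr_fun measurableSet_Ioo fun x hx => ?_
    have hx' : -(x / t) < 0 := neg_lt_zero.2 (div_pos hx.1 ht)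
    simp only [sol, not_le.2 ht, if_false, neg_div, glue_neg Gl Gr hx', neg_neg]
  · intro φ hφ
    obtain ⟨M, C, hM, hC0, hsup, hbd, hTc, hXc⟩ := testFn_data hφ
    have h := trace_aux (b := B) (R := R) hr.meas
      (fun s => hb _ hB _ (uIcc_subset_Icc hB hR (hr.mem s))) hr.tr
      hφ.1.continuous (M := M) (C := C) (fun t x h => (hsup t x (Or.inl h)).1)
      (fun z => (hbd _).1)
    refine h.congr' (Eventually.of_forall fun ε => ?_)
    simp only
    congr 1
    refine setIntegral_congr_fun measurableSet_Ioi fun t ht => ?_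
    have ht : (0:ℝ) < t := ht
    refine setIntegral_congr_fun measurableSet_Ioo fun x hx => ?_
    simp only [sol, not_le.2 ht, if_false, glue_pos Gl Gr (div_pos hx.1 ht)]
  · intro t ht x hx
    have hx' : x / t < 0 := div_neg_of_neg_of_pos hx ht
    simp only [sol, not_le.2 ht, if_false, glue_neg Gl Gr hx']
    have := hl.mem (-(x / t))
    rwa [uIcc_of_ge hLA] at this
  · filter_upwards [hS.sol_tendsto le_rfl] with x hx hx0
    have : sol ρL ρR (glue Gl Gr) 0 x = ρL := by simp [sol, riem, hx0]
    rw [this] at hx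
    exact hx.mono_left (nhdsWithin_mono _ Ioi_subset_Ici_self)
  · intro hlt
    have := hl.tr.eventually (lt_mem_nhds hlt)
    obtain ⟨δ, hδ, h⟩ := mem_nhdsGT_iff_exists_Ioo_subset.1 this
    refine ⟨δ, hδ, fun t ht x hx => ?_⟩
    have hx' : x / t < 0 := div_neg_of_neg_of_pos hx.2 ht
    simp only [sol, not_le.2 ht, if_false, glue_neg Gl Gr hx']
    refine h ⟨by linarith, ?_⟩
    rw [← neg_div, div_lt_iff₀ ht]; linarith [hx.1]

lemma wAvg_facts {w : ℝ → ℝ} (hW : AW w) {R ρL A : ℝ} {ρ : ℝ → ℝ → ℝ} (hreg : RegSol R ρ)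
    (hmem : ∀ t > 0, ∀ x < 0, ρ t x ∈ Icc ρL A)
    (hlim : ∀ᵐ x : ℝ, x < 0 → Tendsto (fun t => ρ t x) (nhdsWithin 0 (Ioi 0)) (nhds ρL)) :
    (∀ t > 0, wAvg w ρ t ∈ Icc ρL A) ∧
      Tendsto (wAvg w ρ) (nhdsWithin 0 (Ioi 0)) (nhds ρL) := by
  obtain ⟨hw0, -, hw1, -⟩ := hW
  have hwi : IntegrableOn w (Iic 0) := by
    by_contra hn
    rw [integral_undef hn] at hw1
    exact zero_ne_one hw1
  have hmt : ∀ t, Measurable (fun x => ρ t x) := fun t => hreg.1.of_uncurry_left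
  have hbR : ∀ t x, ‖ρ t x‖ ≤ R := fun t x => by
    rw [Real.norm_eq_abs, abs_of_nonneg (hreg.2.1 t x).1]; exact (hreg.2.1 t x).2
  have hi : ∀ t, IntegrableOn (fun x => w x * ρ t x) (Iic 0) := fun t =>
    Integrable.mul_bdd (c := R) hwi (hmt t).aestronglyMeasurable
      (Eventually.of_forall fun x => hbR t x)
  have hne : ∀ᵐ x ∂(volume.restrict (Iic (0:ℝ))), x < 0 := by
    have h0 : ∀ᵐ x : ℝ, x ≠ 0 := by
      have := (countable_singleton (0:ℝ)).ae_notMem volume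
      simpa using this
    rw [ae_restrict_iff' measurableSet_Iic]
    filter_upwards [h0] with x hx hx' using lt_of_le_of_ne hx' hx
  have hc : ∀ r : ℝ, ∫ x in Iic (0:ℝ), w x * r = r := by
    intro r; rw [integral_mul_const, hw1, one_mul]
  refine ⟨fun t ht => ⟨?_, ?_⟩, ?_⟩
  · rw [← hc ρL]
    refine integral_mono_ae (hwi.mul_const _) (hi t) ?_
    filter_upwards [hne] with x hx
    exact mul_le_mul_of_nonneg_left (hmem t ht x hx).1 (hw0 x hx.le)
  · rw [← hc A]
    refine integral_mono_ae (hi t) (hwi.mul_const _) ?_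
    filter_upwards [hne] with x hx
    exact mul_le_mul_of_nonneg_left (hmem t ht x hx).2 (hw0 x hx.le)
  · rw [← hc ρL]
    refine tendsto_integral_filter_of_dominated_convergence (fun x => ‖w x‖ * R)
      (Eventually.of_forall fun t => (hi t).aestronglyMeasurable) ?_ (hwi.norm.mul_const R) ?_
    · refine Eventually.of_forall fun t => Eventually.of_forall fun x => ?_
      rw [norm_mul]
      exact mul_le_mul_of_nonneg_left (hbR t x) (norm_nonneg _)
    · filter_upwards [hne, ae_restrict_of_ae hlim] with x hx hx'
      exact (hx' hx).const_mul _

lemma lt_of_deriv_pos {f : ℝ → ℝ} {K : NNReal} {x y : ℝ} (hxy : x < y)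
    (hf : LipschitzOnWith K f (Icc x y))
    (hd : ∀ᵐ z ∂(volume.restrict (Icc x y)), 0 < deriv f z) : f x < f y := by
  rw [← uIcc_of_le hxy.le] at hf
  have hac := hf.absolutelyContinuousOnInterval
  have h1 := hac.integral_deriv_eq_sub
  have h2 := hac.intervalIntegrable_deriv
  rw [intervalIntegral.integral_of_le hxy.le] at h1
  rw [intervalIntegrable_iff_integrableOn_Ioc_of_le hxy.le] at h2
  have hd' : ∀ᵐ z ∂(volume.restrict (Ioc x y)), 0 < deriv f z :=
    ae_restrict_of_ae_restrict_of_subset Ioc_subset_Icc_self hd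
  have h3 : 0 < ∫ z in Ioc x y, deriv f z := by
    rw [setIntegral_pos_iff_support_of_nonneg_ae (hd'.mono fun z hz => hz.le) h2]
    have : volume (Ioc x y) ≤ volume (Function.support (deriv f) ∩ Ioc x y) := by
      rw [ae_restrict_iff' measurableSet_Ioc] at hd'
      refine measure_mono_ae ?_
      filter_upwards [hd'] with z hz hz'
      exact ⟨(hz hz').ne', hz'⟩
    refine lt_of_lt_of_le ?_ this
    simp [hxy]
  linarith

lemma AF.strict {R ρb : ℝ} {f : ℝ → ℝ} (h : AF R ρb f) :
    StrictMonoOn f (Icc 0 ρb) ∧ StrictAntiOn f (Icc ρb R) := by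
  obtain ⟨hR, ⟨K, hK⟩, -, -, -, hb, hd⟩ := h
  constructor
  · intro x hx y hy hxy
    have hsub : Icc x y ⊆ Icc 0 R := Icc_subset_Icc hx.1 (hy.2.trans hb.2.le)
    refine lt_of_deriv_pos hxy (hK.mono hsub) ?_
    have := ae_restrict_of_ae_restrict_of_subset hsub hd
    filter_upwards [this, ae_restrict_mem measurableSet_Icc] with z hz hz'
    exact pos_of_mul_pos_left hz (by linarith [hz'.2, hy.2])
  · intro x hx y hy hxy
    have hsub : Icc x y ⊆ Icc 0 R := Icc_subset_Icc (hb.1.le.trans hx.1) hy.2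
    have := ae_restrict_of_ae_restrict_of_subset hsub hd
    have h := lt_of_deriv_pos (f := fun z => - f z) hxy (hK.mono hsub).neg (by
      filter_upwards [this, ae_restrict_mem measurableSet_Icc] with z hz hz'
      rw [deriv.fun_neg]
      have h1 : ρb - z ≤ 0 := by linarith [hz'.1, hx.1]
      by_contra! hle
      have : deriv f z * (ρb - z) ≤ 0 := mul_nonpos_of_nonneg_of_nonpos (by linarith) h1
      linarith)
    linarith

/-- in case (CN3) the constrained Riemann problem admits (locally in time)
two distinct entropy weak solutions, one with boundary flux `f ρL` (classical) and one
with boundary flux `p(ρL+)` (nonclassical). -/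
theorem stmt9 (R ρb : ℝ) (f w p : ℝ → ℝ) (hF : AF R ρb f) (hW : AW w)
    (hP : AP2 R (f ρb) p) (ρL ρR : ℝ) (hL : ρL ∈ Icc (0:ℝ) R) (hR' : ρR ∈ Icc (0:ℝ) R)
    (h1 : ρR ≤ ρL) (h2 : ρL ≤ ρb)
    (h3 : pplus R p ρL < f ρL) (h4 : f ρL ≤ pminus p ρL) :
    ∃ T > (0:ℝ), ∃ ρ1 ρ2 : ℝ → ℝ → ℝ, ∃ γm1 γp1 γm2 γp2 : ℝ → ℝ,
      EWSolOn R (f ρb) T f w p (riem ρL ρR) ρ1 γm1 γp1 ∧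
      EWSolOn R (f ρb) T f w p (riem ρL ρR) ρ2 γm2 γp2 ∧
      (∀ᵐ t ∂(volume.restrict (Ioo (0:ℝ) T)), f (γm1 t) = f ρL ∧ f (γp1 t) = f ρL) ∧
      (∀ᵐ t ∂(volume.restrict (Ioo (0:ℝ) T)),
        f (γm2 t) = pplus R p ρL ∧ f (γp2 t) = pplus R p ρL) ∧
      ∀ τ ∈ Ioc (0:ℝ) T, ¬ aeEqOn τ ρ1 ρ2 := by
  obtain ⟨hmono, hanti⟩ := hF.strict
  obtain ⟨hR0, ⟨K, hK⟩, hfnn, hf0, hfR, hρb, -⟩ := hF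
  obtain ⟨hpa, hpm, hpf⟩ := hP
  have hfc : ContinuousOn f (Icc 0 R) := hK.continuousOn
  obtain ⟨g, hg, hfg⟩ := hK.extend_real
  have hng : LipschitzWith K (fun m => - g m) := hg.neg
  have hρb0 := hρb.1
  have hρbR := hρb.2
  have hLR : ρL < R := lt_of_le_of_lt h2 hρb.2
  have hfle : ∀ k ∈ Icc (0:ℝ) R, f k ≤ f ρb := by
    intro k hk
    rcases le_total k ρb with h | h
    · exact hmono.monotoneOn ⟨hk.1, h⟩ ⟨hρb.1.le, le_rfl⟩ h
    · exact hanti.antitoneOn ⟨le_rfl, hρb.2.le⟩ ⟨h, hk.2⟩ h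
  -- the value of `p` to the right of `ρL`
  have hsub : ∀ ξ, 0 ≤ ξ → Ioc ξ R ⊆ Icc 0 R := fun ξ h z hz => ⟨h.trans hz.1.le, hz.2⟩
  have hbdd : ∀ ξ, 0 ≤ ξ → BddAbove (p '' Ioc ξ R) := fun ξ h =>
    (hpf.subset (image_mono (hsub ξ h))).bddAbove
  have hcdef : pplus R p ρL = sSup (p '' Ioc ρL R) := by
    simp [pplus, not_le.2 hLR]
  obtain ⟨y, hy, hyc⟩ : sSup (p '' Ioc ρL R) ∈ p '' Ioc ρL R :=
    Set.Nonempty.csSup_mem ⟨p R, R, ⟨hLR, le_rfl⟩, rfl⟩ (hpf.subset (image_mono (hsub ρL hL.1)))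
  rw [← hcdef] at hyc
  have hyI : y ∈ Icc 0 R := hsub ρL hL.1 hy
  generalize hc : pplus R p ρL = c at *
  have hc0 : 0 < c := hyc ▸ (hpm y hyI).1
  have hcb : c ≤ f ρb := hyc ▸ (hpm y hyI).2
  have hfb : 0 < f ρb := lt_of_lt_of_le hc0 hcb
  have hcL : c < f ρL := h3
  have hfLb : f ρL ≤ f ρb := hfle ρL hL
  -- first solution
  obtain ⟨Gl1, hl1⟩ := fan_max (g := fun m => - g m) (a := ρL) (b := ρL) hng le_rfl
    (fun m hm => absurd hm.1 (not_le.2 hm.2))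
  obtain ⟨Gr1, hr1⟩ := fan_max (g := g) (a := ρR) (b := ρL) hg h1 (fun m hm => by
    rw [← hfg hL, ← hfg ⟨hR'.1.trans hm.1, hm.2.le.trans hL.2⟩]
    exact hmono ⟨hR'.1.trans hm.1, hm.2.le.trans h2⟩ ⟨hL.1, h2⟩ hm.2)
  obtain ⟨ρ1, reg1, ent1, lt1, rt1, mem1, lim1, -⟩ :=
    build (fmax := f ρb) (c := f ρL) hg.continuous hfg hl1 hr1 hL hR' hL hL le_rfl (by
      intro k hk
      have := mul_nonneg (sub_nonneg.2 ((div_le_one hfb).2 hfLb)) (hfnn k hk)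
      linarith)
  -- second solution
  obtain ⟨A, hA, hfA⟩ : c ∈ f '' Icc ρb R := by
    refine intermediate_value_Icc' hρbR.le (hfc.mono (Icc_subset_Icc_left hρb0.le)) ?_
    rw [hfR]; exact ⟨hc0.le, hcb⟩
  obtain ⟨B, hB, hfB⟩ : c ∈ f '' Icc 0 ρL := by
    refine intermediate_value_Icc hL.1 (hfc.mono (Icc_subset_Icc_right hL.2)) ?_
    rw [hf0]; exact ⟨hc0.le, hcL.le⟩
  have hAI : A ∈ Icc 0 R := ⟨hρb0.le.trans hA.1, hA.2⟩
  have hBI : B ∈ Icc 0 R := ⟨hB.1, hB.2.trans hL.2⟩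
  have hLA : ρL < A := by
    refine lt_of_le_of_ne (h2.trans hA.1) ?_
    rintro rfl
    exact hcL.ne' hfA
  have hBL : B < ρL := by
    refine lt_of_le_of_ne hB.2 ?_
    rintro rfl
    exact hcL.ne' hfB
  obtain ⟨Gl2, hl2⟩ := fan_max (g := fun m => - g m) (a := ρL) (b := A) hng hLA.le
    (fun m hm => by
      have hmI : m ∈ Icc 0 R := ⟨hL.1.trans hm.1, hm.2.le.trans hA.2⟩
      show - g m < - g A
      rw [← hfg hAI, ← hfg hmI, neg_lt_neg_iff, hfA]
      rcases le_total m ρb with h | h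
      · exact hcL.trans_le (hmono.monotoneOn ⟨hL.1, h2⟩ ⟨hmI.1, h⟩ hm.1)
      · rw [← hfA]; exact hanti ⟨h, hmI.2⟩ hA hm.2)
  obtain ⟨Gr2, hr2⟩ : ∃ G, RFan g B ρR G := by
    rcases le_total ρR B with h | h
    · refine fan_max hg h fun m hm => ?_
      rw [← hfg hBI, ← hfg ⟨hR'.1.trans hm.1, hm.2.le.trans hBI.2⟩]
      exact hmono ⟨hR'.1.trans hm.1, hm.2.le.trans (hB.2.trans h2)⟩ ⟨hB.1, hB.2.trans h2⟩ hm.2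
    · refine fan_min hg h fun m hm => ?_
      rw [← hfg hBI, ← hfg ⟨hB.1.trans hm.1.le, hm.2.trans hR'.2⟩]
      exact hmono ⟨hB.1, hB.2.trans h2⟩ ⟨hB.1.trans hm.1.le, hm.2.trans (h1.trans h2)⟩ hm.1
  obtain ⟨ρ2, reg2, ent2, lt2, rt2, mem2, lim2, pos2⟩ :=
    build (fmax := f ρb) (c := c) hg.continuous hfg hl2 hr2 hL hR' hAI hBI hLA.le (by
      intro k hk
      have hq := mul_nonneg (sub_nonneg.2 ((div_le_one hfb).2 hcb)) (hfnn k hk)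
      have hq2 := mul_nonneg hc0.le (sub_nonneg.2 ((div_le_one hfb).2 (hfle k hk)))
      have heq : c / f ρb * f k = c * (f k / f ρb) := by ring
      rw [hfA, hfB]
      rcases lt_trichotomy k B with h | h | h
      · rw [Real.sign_of_pos (by linarith : 0 < A - k), Real.sign_of_pos (by linarith : 0 < B - k)]
        linarith
      · have : f k = c := by rw [h, hfB]
        rw [this] at hq ⊢
        simp only [sub_self, mul_zero]
        linarith
      · rcases lt_trichotomy k A with h' | h' | h'
        · rw [Real.sign_of_pos (by linarith : 0 < A - k),
            Real.sign_of_neg (by linarith : B - k < 0)]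
          linarith
        · have : f k = c := by rw [h', hfA]
          rw [this] at hq ⊢
          simp only [sub_self, mul_zero]
          linarith
        · rw [Real.sign_of_neg (by linarith : A - k < 0),
            Real.sign_of_neg (by linarith : B - k < 0)]
          linarith)
  obtain ⟨av1, -⟩ := wAvg_facts hW reg1 mem1 lim1
  obtain ⟨av2, tend2⟩ := wAvg_facts hW reg2 mem2 lim2
  obtain ⟨δ, hδ, hpos2⟩ := pos2 hLA
  obtain ⟨T, hT, hTy⟩ := mem_nhdsGT_iff_exists_Ioo_subset.1 (tend2 (Iio_mem_nhds hy.1))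
  have hT : (0:ℝ) < T := hT
  refine ⟨T, hT, ρ1, ρ2, fun _ => ρL, fun _ => ρL, fun _ => A, fun _ => B, ?_, ?_, ?_, ?_, ?_⟩
  · refine ⟨fun _ => f ρL, ⟨reg1, fun _ => ⟨hfnn ρL hL, hfLb⟩, ?_, lt1, rt1, ?_⟩, ?_⟩
    · intro φ h h' _ k hk
      exact ent1 φ h h' k hk
    · exact Eventually.of_forall fun _ => ⟨le_rfl, le_rfl⟩
    · filter_upwards [ae_restrict_mem measurableSet_Ioo] with t ht
      have : wAvg w ρ1 t = ρL := le_antisymm (av1 t ht.1).2 (av1 t ht.1).1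
      rw [this, hc]
      exact ⟨hcL.le, h4⟩
  · refine ⟨fun _ => c, ⟨reg2, fun _ => ⟨hc0.le, hcb⟩, ?_, lt2, rt2, ?_⟩, ?_⟩
    · intro φ h h' _ k hk
      exact ent2 φ h h' k hk
    · exact Eventually.of_forall fun _ => ⟨hfA.le, hfB.le⟩
    · filter_upwards [ae_restrict_mem measurableSet_Ioo] with t ht
      have hξ1 : ρL ≤ wAvg w ρ2 t := (av2 t ht.1).1
      have hξ2 : wAvg w ρ2 t < y := hTy ht
      generalize wAvg w ρ2 t = ξ at hξ1 hξ2
      have hξR : ξ < R := hξ2.trans_le hy.2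
      constructor
      · rw [pplus, if_neg (not_le.2 hξR), hcdef]
        exact csSup_le_csSup (hbdd ρL hL.1) ⟨p R, R, ⟨hξR, le_rfl⟩, rfl⟩
          (image_mono (Ioc_subset_Ioc_left hξ1))
      · rw [pminus]
        split_ifs with h
        · rw [← hyc]; exact hpa ⟨le_rfl, hR0.le⟩ hyI hyI.1
        · refine le_csInf ⟨p 0, 0, ⟨le_rfl, not_le.1 h⟩, rfl⟩ ?_
          rintro _ ⟨m, hm, rfl⟩
          rw [← hyc]
          exact hpa ⟨hm.1, (hm.2.trans hξR).le⟩ hyI (hm.2.trans hξ2).le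
  · exact Eventually.of_forall fun _ => ⟨rfl, rfl⟩
  · exact Eventually.of_forall fun _ => ⟨hfA, hfB⟩
  · intro τ hτ hae
    have hτ0 := hτ.1
    rw [aeEqOn, ae_restrict_iff' (measurableSet_Ioo.prod MeasurableSet.univ)] at hae
    set U : Set (ℝ × ℝ) := {z | 0 < z.1} ∩ {z | z.1 < τ} ∩ {z | -(δ * z.1) < z.2} ∩ {z | z.2 < 0}
      with hU
    have hUo : IsOpen U := by
      refine ((IsOpen.inter ?_ ?_).inter ?_).inter ?_
      · exact isOpen_lt (by fun_prop) (by fun_prop)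
      · exact isOpen_lt (by fun_prop) (by fun_prop)
      · exact isOpen_lt (by fun_prop) (by fun_prop)
      · exact isOpen_lt (by fun_prop) (by fun_prop)
    have hUn : U.Nonempty := by
      have := mul_pos hδ hτ0
      refine ⟨(τ / 2, -(δ * τ / 4)), ⟨⟨?_, ?_⟩, ?_⟩, ?_⟩ <;>
        simp only [mem_setOf_eq] <;> linarith
    have h0 : volume U = 0 := by
      refine measure_mono_null ?_ (ae_iff.1 hae)
      rintro ⟨t, x⟩ ⟨⟨⟨ht, ht'⟩, hx⟩, hx'⟩
      simp only [mem_setOf_eq] at ht ht' hx hx' ⊢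
      intro hh
      have e := hh ⟨⟨ht, ht'⟩, trivial⟩
      have e1 := (mem1 t ht x hx').2
      have e2 := hpos2 t ht x ⟨hx, hx'⟩
      linarith
    exact (hUo.measure_pos volume hUn).ne' h0

end

end CRP
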